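/- Let G/K be a generalized flag manifold whose isotropy representation decomposes as 𝔪 = 𝔪₁ ⊕ ⋯ ⊕ 𝔪ₛ with s ≥ 3 pairwise inequivalent irreducible Ad(K)-submodules, and let G/K₁ be the corresponding M-space. If (G/K₁, g) is a g.o. space, then the associated operator Λ of g satisfies Λ|_𝔪 = λ·Id for some λ > 0; that is, g = ⟨·,·⟩ = Λ|_𝔰 + λ B(·,·)|_{𝔪₁ ⊕ 𝔪₂ ⊕ ⋯ ⊕ 𝔪ₛ}. -/

import Mathlib

open Module

/-- A submodule `W` of a Lie algebra is invariant under the (infinitesimal) adjoint action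
of the Lie subalgebra `k`.  For a connected Lie group this corresponds to `Ad(K)`-invariance. -/
def AdInvariant {𝔤 : Type*} [LieRing 𝔤] [LieAlgebra ℝ 𝔤]
    (k : LieSubalgebra ℝ 𝔤) (W : Submodule ℝ 𝔤) : Prop :=
  ∀ x ∈ k, ∀ w ∈ W, ⁅x, w⁆ ∈ W

/-- `W` is a nonzero irreducible module for the adjoint action of `k`
(i.e. an irreducible `Ad(K)`-module). -/
def AdIrreducible {𝔤 : Type*} [LieRing 𝔤] [LieAlgebra ℝ 𝔤]
    (k : LieSubalgebra ℝ 𝔤) (W : Submodule ℝ 𝔤) : Prop :=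
  AdInvariant k W ∧ W ≠ ⊥ ∧
    ∀ U : Submodule ℝ 𝔤, U ≤ W → AdInvariant k U → U = ⊥ ∨ U = W

/-- `W` is a reducible `Ad(K)`-module: invariant, with a proper nonzero invariant submodule. -/
def AdReducible {𝔤 : Type*} [LieRing 𝔤] [LieAlgebra ℝ 𝔤]
    (k : LieSubalgebra ℝ 𝔤) (W : Submodule ℝ 𝔤) : Prop :=
  AdInvariant k W ∧ ∃ U : Submodule ℝ 𝔤, U ≤ W ∧ AdInvariant k U ∧ U ≠ ⊥ ∧ U ≠ W

/-- Equivalence of two `Ad(K)`-modules `U` and `V`: an injective intertwining linear map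
carrying `U` onto `V`. -/
def AdEquiv {𝔤 : Type*} [LieRing 𝔤] [LieAlgebra ℝ 𝔤]
    (k : LieSubalgebra ℝ 𝔤) (U V : Submodule ℝ 𝔤) : Prop :=
  ∃ f : 𝔤 →ₗ[ℝ] 𝔤, Submodule.map f U = V ∧ (∀ u ∈ U, f u = 0 → u = 0) ∧
    ∀ x ∈ k, ∀ u ∈ U, f ⁅x, u⁆ = ⁅x, f u⁆

/-- The g.o. property of the `G`-invariant metric with associated operator `Λ` on the
homogeneous space with isotropy algebra `k` and tangent space `n`: every geodesic through
the origin is homogeneous, i.e. (by the standard criterion) for every `x ∈ n` there is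
`a ∈ k` such that `⁅a + x, Λ x⁆ ∈ k`. -/
def IsGOMetric {𝔤 : Type*} [LieRing 𝔤] [LieAlgebra ℝ 𝔤]
    (k : LieSubalgebra ℝ 𝔤) (n : Submodule ℝ 𝔤) (Λ : 𝔤 →ₗ[ℝ] 𝔤) : Prop :=
  ∀ x ∈ n, ∃ a ∈ k, ⁅a + x, Λ x⁆ ∈ k.toSubmodule

/-- An `ad`-invariant inner product on a real Lie algebra. -/
structure IsInvInner {𝔤 : Type*} [LieRing 𝔤] [LieAlgebra ℝ 𝔤]
    (B : 𝔤 →ₗ[ℝ] 𝔤 →ₗ[ℝ] ℝ) : Prop where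
  symm : ∀ x y, B x y = B y x
  pos : ∀ x, x ≠ 0 → 0 < B x x
  inv : ∀ x y z, B ⁅x, y⁆ z = B x ⁅y, z⁆

section InvInner

variable {𝔤 : Type*} [LieRing 𝔤] [LieAlgebra ℝ 𝔤] {B : 𝔤 →ₗ[ℝ] 𝔤 →ₗ[ℝ] ℝ}

theorem IsInvInner.eq_zero (hB : IsInvInner B) {x : 𝔤} (h : B x x = 0) : x = 0 := by
  by_contra hx
  exact (hB.pos x hx).ne' h

theorem IsInvInner.nonneg (hB : IsInvInner B) (x : 𝔤) : 0 ≤ B x x := by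
  by_cases hx : x = 0
  · simp [hx]
  · exact (hB.pos x hx).le

theorem IsInvInner.inv_left (hB : IsInvInner B) (x y z : 𝔤) : B ⁅x, y⁆ z = -B y ⁅x, z⁆ := by
  rw [← lie_skew, map_neg, LinearMap.neg_apply, hB.inv]

/-- The inner product space structure determined by an invariant inner product. -/
@[reducible] noncomputable def IsInvInner.core (hB : IsInvInner B) :
    InnerProductSpace.Core ℝ 𝔤 where
  inner x y := B x y
  conj_inner_symm x y := by simp [hB.symm y x]
  re_inner_nonneg x := by simpa using hB.nonneg x
  add_left x y z := by simp
  smul_left x y r := by simp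
  definite x h := hB.eq_zero h

theorem IsInvInner.exists_orthonormal [FiniteDimensional ℝ 𝔤] (hB : IsInvInner B)
    (W : Submodule ℝ 𝔤) :
    ∃ (n : ℕ) (b : Fin n → 𝔤), (∀ i, b i ∈ W) ∧ (∀ i, B (b i) (b i) = 1) ∧
      ∀ x ∈ W, x = ∑ i, B (b i) x • b i := by
  let _ : NormedAddCommGroup 𝔤 := hB.core.toNormedAddCommGroup
  let _ : InnerProductSpace ℝ 𝔤 := InnerProductSpace.ofCore hB.core.toCore
  let b := stdOrthonormalBasis ℝ W
  refine ⟨_, fun i => (b i : 𝔤), fun i => (b i).2, fun i => ?_, fun x hx => ?_⟩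
  · have h := b.orthonormal.1 i
    have h2 : inner ℝ (b i) (b i) = 1 := by
      rw [real_inner_self_eq_norm_sq, h]; norm_num
    exact h2
  · have h := congrArg (Subtype.val) (b.sum_repr' ⟨x, hx⟩)
    rw [AddSubmonoidClass.coe_finsetSum] at h
    exact h.symm

theorem IsInvInner.exists_eigenvector [FiniteDimensional ℝ 𝔤] (hB : IsInvInner B)
    {W : Submodule ℝ 𝔤} (hW : W ≠ ⊥) {A : 𝔤 →ₗ[ℝ] 𝔤} (hA : ∀ x ∈ W, A x ∈ W)
    (hsym : ∀ x ∈ W, ∀ y ∈ W, B (A x) y = B x (A y)) :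
    ∃ c : ℝ, ∃ x ∈ W, x ≠ 0 ∧ A x = c • x := by
  let _ : NormedAddCommGroup 𝔤 := hB.core.toNormedAddCommGroup
  let _ : InnerProductSpace ℝ 𝔤 := InnerProductSpace.ofCore hB.core.toCore
  have : Nontrivial W := Submodule.nontrivial_iff_ne_bot.2 hW
  have hS : (A.restrict hA).IsSymmetric := fun x y => hsym x x.2 y y.2
  obtain ⟨v, hv⟩ := hS.hasEigenvalue_iSup_of_finiteDimensional.exists_hasEigenvector
  exact ⟨_, v, v.2, fun h => hv.2 (Subtype.ext h), congrArg Subtype.val hv.apply_eq_smul⟩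

/-- Schur's lemma for symmetric equivariant operators on an irreducible module. -/
theorem AdIrreducible.exists_scalar [FiniteDimensional ℝ 𝔤] (hB : IsInvInner B)
    {k : LieSubalgebra ℝ 𝔤} {W : Submodule ℝ 𝔤} (hW : AdIrreducible k W)
    {A : 𝔤 →ₗ[ℝ] 𝔤} (hA : ∀ x ∈ W, A x ∈ W)
    (hsym : ∀ x ∈ W, ∀ y ∈ W, B (A x) y = B x (A y))
    (hequiv : ∀ a ∈ k, ∀ x ∈ W, A ⁅a, x⁆ = ⁅a, A x⁆) :
    ∃ c : ℝ, ∀ x ∈ W, A x = c • x := by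
  obtain ⟨c, x, hx, hx0, hxc⟩ := hB.exists_eigenvector hW.2.1 hA hsym
  refine ⟨c, fun y hy => ?_⟩
  have hU : W ⊓ LinearMap.ker (A - c • LinearMap.id) = W := by
    refine (hW.2.2 _ inf_le_left ?_).resolve_left ?_
    · rintro a ha w ⟨hw, hwc⟩
      refine ⟨hW.1 a ha w hw, ?_⟩
      have hwc' : A w = c • w := by simpa [sub_eq_zero] using hwc
      simp [hequiv a ha w hw, hwc']
    · intro h
      have : x ∈ W ⊓ LinearMap.ker (A - c • LinearMap.id) := ⟨hx, by simp [hxc]⟩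
      rw [h] at this
      exact hx0 (by simpa using this)
  rw [← hU] at hy
  simpa [sub_eq_zero] using hy.2

/-- Orthogonal projection onto a subspace. -/
theorem IsInvInner.exists_proj [FiniteDimensional ℝ 𝔤] (hB : IsInvInner B)
    (W : Submodule ℝ 𝔤) :
    ∃ P : 𝔤 →ₗ[ℝ] 𝔤, (∀ x, P x ∈ W) ∧ ∀ x, ∀ w ∈ W, B (P x) w = B x w := by
  obtain ⟨n, b, hbW, -, hb⟩ := hB.exists_orthonormal W
  refine ⟨∑ i, (B (b i)).smulRight (b i), fun x => ?_, fun x w hw => ?_⟩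
  · simp only [LinearMap.sum_apply, LinearMap.smulRight_apply]
    exact W.sum_mem fun i _ => W.smul_mem _ (hbW i)
  · conv_rhs => rw [hb w hw]
    simp [hB.symm x, mul_comm]

/-- An equivariant operator maps an irreducible module into the orthogonal complement of
any inequivalent one. -/
theorem AdIrreducible.orthogonal_of_not_adEquiv [FiniteDimensional ℝ 𝔤] (hB : IsInvInner B)
    {k : LieSubalgebra ℝ 𝔤} {U W : Submodule ℝ 𝔤} (hU : AdIrreducible k U)
    (hW : AdIrreducible k W) (hUW : ¬ AdEquiv k U W) {A : 𝔤 →ₗ[ℝ] 𝔤}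
    (hequiv : ∀ a ∈ k, ∀ x ∈ U, A ⁅a, x⁆ = ⁅a, A x⁆) :
    ∀ x ∈ U, ∀ w ∈ W, B (A x) w = 0 := by
  obtain ⟨P, hPW, hP⟩ := hB.exists_proj W
  have hPk : ∀ a ∈ k, ∀ x, P ⁅a, x⁆ = ⁅a, P x⁆ := by
    intro a ha x
    rw [← sub_eq_zero]
    have hmem : P ⁅a, x⁆ - ⁅a, P x⁆ ∈ W := W.sub_mem (hPW _) (hW.1 a ha _ (hPW x))
    apply hB.eq_zero
    rw [LinearMap.map_sub₂, hP _ _ hmem, hB.inv_left, hB.inv_left,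
      hP x _ (hW.1 a ha _ hmem), sub_self]
  set f : 𝔤 →ₗ[ℝ] 𝔤 := P ∘ₗ A with hf
  have hfk : ∀ a ∈ k, ∀ x ∈ U, f ⁅a, x⁆ = ⁅a, f x⁆ := by
    intro a ha x hx
    simp [hf, hequiv a ha x hx, hPk a ha]
  rcases hU.2.2 (U ⊓ LinearMap.ker f) inf_le_left (by
    rintro a ha w ⟨hw, hw0⟩
    refine ⟨hU.1 a ha w hw, ?_⟩
    rw [SetLike.mem_coe, LinearMap.mem_ker] at hw0 ⊢
    rw [hfk a ha w hw, hw0, lie_zero]) with h | h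
  · have hinj : ∀ u ∈ U, f u = 0 → u = 0 := fun u hu hu0 => by
      have : u ∈ U ⊓ LinearMap.ker f := ⟨hu, hu0⟩
      simpa [h] using this
    refine absurd ⟨f, (hW.2.2 (U.map f) ?_ ?_).resolve_left ?_, hinj, hfk⟩ hUW
    · rintro _ ⟨x, -, rfl⟩
      exact hPW _
    · rintro a ha _ ⟨x, hx, rfl⟩
      exact ⟨_, hU.1 a ha x hx, hfk a ha x hx⟩
    · intro h0
      refine hU.2.1 ((Submodule.eq_bot_iff _).2 fun u hu => hinj u hu ?_)
      have : f u ∈ U.map f := ⟨u, hu, rfl⟩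
      simpa [h0] using this
  · intro x hx w hw
    rw [← h] at hx
    have h0 : P (A x) = 0 := hx.2
    rw [← hP _ _ hw, h0, map_zero, LinearMap.zero_apply]

end InvInner

section RootGeometry

variable {E ι : Type*} [AddCommGroup E] [Module ℝ E] {B : E →ₗ[ℝ] E →ₗ[ℝ] ℝ}

theorem eq_smul_of_eq_sign_smul_add {v α : E} (hα : α ≠ 0) {σ τ m : ℝ} (hσ : σ = 1 ∨ σ = -1)
    (hm : τ * m ≠ 0) (h : v = σ • (v + τ • m • α)) : v = (-(τ * m) / 2) • α := by
  rcases hσ with rfl | rfl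
  · have h0 : (τ * m) • α = 0 := by
      rw [one_smul, left_eq_add] at h
      rw [mul_smul, h]
    exact absurd h0 (smul_ne_zero hm hα)
  · have h2 : (2 : ℝ) • v = (2 : ℝ) • (-(τ * m) / 2) • α := by
      nth_rewrite 1 [two_smul, h]
      module
    exact smul_right_injective E two_ne_zero h2

theorem eq_smul_of_smul_eq_sign_smul_add {v α : E} {σ τ m : ℝ} (hσ : σ = 1 ∨ σ = -1)
    (h : m • α = σ • (v + τ • m • α)) : v = ((σ - τ) * m) • α := by
  have h1 : v = σ • σ • (v + τ • m • α) - τ • m • α := by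
    rcases hσ with rfl | rfl <;> module
  rw [h1, ← h]
  module

/-- A function on a system of vectors with additive structure `N` that separates only those
pairs whose sums stay inside the pair is constant, provided that the system is indecomposable
and has at least three elements. -/
theorem constant_of_indecomposable_rootSystem
    (hpos : ∀ x, x ≠ 0 → 0 < B x x)
    (u : ι → E) (N : ι → ι → ι → Prop) (lam : ι → ℝ)
    (hu0 : ∀ i, u i ≠ 0)
    (hNcomm : ∀ i j k, N i j k → N j i k)
    (hNrot : ∀ i j k, N i j k → N i k j)
    (hNadd : ∀ i j k, N i j k → ∃ σ τ : ℝ, (σ = 1 ∨ σ = -1) ∧ (τ = 1 ∨ τ = -1) ∧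
      u k = σ • (u i + τ • u j))
    (hNdiff : ∀ i j, i ≠ j → B (u i) (u j) ≠ 0 → ∃ k, N i j k ∧
      ∃ σ τ : ℝ, (σ = 1 ∨ σ = -1) ∧ (τ = 1 ∨ τ = -1) ∧ τ * B (u i) (u j) < 0 ∧
        u k = σ • (u i + τ • u j))
    (hlam : ∀ i j k, lam i ≠ lam j → N i j k → k = i ∨ k = j)
    (hconn : ∀ I : Set ι, I.Nonempty → Iᶜ.Nonempty → ∃ i ∈ I, ∃ j ∉ I, ∃ k, N i j k)
    (hthree : ∀ i j : ι, ∃ k, k ≠ i ∧ k ≠ j) (i j : ι) : lam i = lam j := by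
  by_contra hne
  -- distinct indices have non-proportional or differently scaled vectors
  have hdist : ∀ i j, i ≠ j → ∀ c : ℝ, (c = 1 ∨ c = -1) → u i ≠ c • u j := by
    intro i j hij c hc h
    have hp := hpos _ (hu0 j)
    have hb : B (u i) (u j) = c * B (u j) (u j) := by rw [h]; simp
    obtain ⟨k, -, σ, τ, -, hτ, hτ0, hk⟩ := hNdiff i j hij (by
      rw [hb]; rcases hc with rfl | rfl <;> simp [hp.ne'])
    apply hu0 k
    have hcτ : c + τ = 0 := by
      rw [hb] at hτ0
      rcases hc with rfl | rfl <;> rcases hτ with rfl | rfl <;> first | (exfalso; linarith) | norm_num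
    rw [hk, h, ← add_smul, hcτ, zero_smul, smul_zero]
  obtain ⟨i, j, hij, hN⟩ : ∃ i j, lam i ≠ lam j ∧ N i j i := by
    obtain ⟨a, ha, b, hb, k, hN⟩ := hconn {a | lam a = lam i} ⟨i, rfl⟩ ⟨j, fun h => hne h.symm⟩
    have hab : lam a ≠ lam b := fun h => hb (h.symm.trans ha)
    rcases hlam a b k hab hN with rfl | rfl
    · exact ⟨_, _, hab, hN⟩
    · exact ⟨_, _, hab.symm, hNcomm _ _ _ hN⟩
  clear hne
  have hpi := hpos _ (hu0 i)
  obtain ⟨ε, hε, hj⟩ : ∃ ε : ℝ, (ε = 1 ∨ ε = -1) ∧ u j = (2 * ε) • u i := by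
    obtain ⟨σ, τ, hσ, hτ, h⟩ := hNadd _ _ _ (hNrot _ _ _ hN)
    rcases hτ with rfl | rfl
    · exact ⟨σ, hσ, by rw [h]; module⟩
    · exact absurd (by rw [h]; module) (hu0 j)
  have hijne : i ≠ j := fun h => hij (h ▸ rfl)
  have hG : ∀ k, B (u k) (u i) ≠ 0 →
      ∃ c : ℝ, u k = c • u i ∧ (c ^ 2 = 1 / 4 ∨ c ^ 2 = 1 ∨ c ^ 2 = 4 ∨ c ^ 2 = 16) := by
    intro k hk
    by_cases hki : k = i
    · exact ⟨1, by simp [hki], by norm_num⟩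
    by_cases hkj : k = j
    · exact ⟨2 * ε, by rw [hkj, hj], by rcases hε with rfl | rfl <;> norm_num⟩
    by_cases hli : lam k = lam i
    · have hkj0 : B (u k) (u j) ≠ 0 := by
        rw [hj]; rcases hε with rfl | rfl <;> simpa using hk
      obtain ⟨l, hl, σ, τ, hσ, hτ, -, h⟩ := hNdiff k j hkj hkj0
      rcases hlam k j l (hli ▸ hij) hl with rfl | rfl
      · rw [hj] at h
        refine ⟨_, eq_smul_of_eq_sign_smul_add (hu0 i) hσ ?_ h, ?_⟩ <;>
          rcases hτ with rfl | rfl <;> rcases hε with rfl | rfl <;> norm_num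
      · rw [hj] at h
        have h' := eq_smul_of_smul_eq_sign_smul_add hσ h
        refine ⟨_, h', ?_⟩
        have h0 := h' ▸ hu0 k
        rcases hσ with rfl | rfl <;> rcases hτ with rfl | rfl <;> rcases hε with rfl | rfl <;>
          first | (norm_num; done) | exact absurd (by norm_num) h0
    · obtain ⟨l, hl, σ, τ, hσ, hτ, -, h⟩ := hNdiff k i hki hk
      rw [← one_smul ℝ (u i)] at h
      rcases hlam k i l hli hl with rfl | rfl
      · refine ⟨_, eq_smul_of_eq_sign_smul_add (hu0 i) hσ ?_ h, ?_⟩ <;>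
          rcases hτ with rfl | rfl <;> norm_num
      · have h' := eq_smul_of_smul_eq_sign_smul_add (m := 1) hσ (by rw [← h, one_smul])
        refine ⟨_, h', ?_⟩
        have h0 := h' ▸ hu0 k
        rcases hσ with rfl | rfl <;> rcases hτ with rfl | rfl <;>
          first | (norm_num; done) | exact absurd (by norm_num) h0
  have hcoef : ∀ (k : ι) (c : ℝ), u k = c • u i → c ≠ 0 →
      c ^ 2 = 1 / 4 ∨ c ^ 2 = 1 ∨ c ^ 2 = 4 ∨ c ^ 2 = 16 := by
    intro k c hc hc0
    obtain ⟨d, hd, hd2⟩ := hG k (by rw [hc]; simp [hc0, hpi.ne'])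
    rwa [smul_left_injective ℝ (hu0 i) (hc.symm.trans hd)]
  have hG2 : ∀ k, B (u k) (u i) ≠ 0 → k = i ∨ k = j := by
    intro k hk
    by_contra! hkk
    obtain ⟨c, hc, h | h | h | h⟩ := hG k hk
    · have hkj0 : B (u k) (u j) ≠ 0 := by
        rw [hj]; rcases hε with rfl | rfl <;> simpa using hk
      obtain ⟨l, -, σ, τ, hσ, hτ, hneg, hl⟩ := hNdiff k j hkk.2 hkj0
      have hneg' : τ * ε * c < 0 := by
        rw [hj, hc] at hneg
        simp only [map_smul, LinearMap.smul_apply, smul_eq_mul] at hneg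
        by_contra! h0
        nlinarith [mul_nonneg h0 hpi.le]
      have hl' : u l = (σ * (c + 2 * (τ * ε))) • u i := by rw [hl, hc, hj]; module
      have hsq : (σ * (c + 2 * (τ * ε))) ^ 2 = 9 / 4 := by
        have hδ : τ * ε * c = -1 / 2 := by
          have h2 : (τ * ε * c - 1 / 2) * (τ * ε * c + 1 / 2) = 0 := by
            rcases hτ with rfl | rfl <;> rcases hε with rfl | rfl <;> linear_combination h
          rcases mul_eq_zero.1 h2 with h2 | h2 <;> linarith
        rcases hσ with rfl | rfl <;> rcases hτ with rfl | rfl <;> rcases hε with rfl | rfl <;>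
          linear_combination h + 4 * hδ
      have := hcoef l _ hl' (by intro h0; rw [h0] at hsq; norm_num at hsq)
      rw [hsq] at this
      norm_num at this
    · have : c = 1 ∨ c = -1 := sq_eq_sq_iff_eq_or_eq_neg.1 (h.trans (one_pow 2).symm)
      exact hdist k i hkk.1 c this hc
    · refine hdist k j hkk.2 (c * ε / 2) ?_ ?_
      · refine sq_eq_sq_iff_eq_or_eq_neg.1 ?_
        rcases hε with rfl | rfl <;> linear_combination h / 4
      · rw [hj, hc]
        rcases hε with rfl | rfl <;> module
    · obtain ⟨l, -, σ, τ, hσ, hτ, hneg, hl⟩ := hNdiff k i hkk.1 hk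
      have hneg' : τ * c < 0 := by
        rw [hc] at hneg
        simp only [map_smul, LinearMap.smul_apply, smul_eq_mul] at hneg
        by_contra! h0
        nlinarith [mul_nonneg h0 hpi.le]
      have hl' : u l = (σ * (c + τ)) • u i := by rw [hl, hc]; module
      have hsq : (σ * (c + τ)) ^ 2 = 9 := by
        have hδ : τ * c = -4 := by
          have h2 : (τ * c - 4) * (τ * c + 4) = 0 := by
            rcases hτ with rfl | rfl <;> linear_combination h
          rcases mul_eq_zero.1 h2 with h2 | h2 <;> linarith
        rcases hσ with rfl | rfl <;> rcases hτ with rfl | rfl <;> linear_combination h + 2 * hδ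
      have := hcoef l _ hl' (by intro h0; rw [h0] at hsq; norm_num at hsq)
      rw [hsq] at this
      norm_num at this
  obtain ⟨k, hk, l, hl, n, hN⟩ := hconn {k | k ≠ i ∧ k ≠ j} (hthree i j) ⟨i, by simp⟩
  have hk0 : B (u k) (u i) = 0 := by
    by_contra h
    rcases hG2 k h with rfl | rfl
    · exact hk.1 rfl
    · exact hk.2 rfl
  have hpar : ∀ l, (l = i ∨ l = j) → ∃ c : ℝ, c ≠ 0 ∧ u l = c • u i := by
    rintro l (rfl | rfl)
    · exact ⟨1, one_ne_zero, by simp⟩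
    · exact ⟨_, by rcases hε with rfl | rfl <;> norm_num, hj⟩
  obtain ⟨c, hc0, hc⟩ := hpar l (by
    by_contra! h
    exact hl h)
  obtain ⟨σ, τ, hσ, hτ, hn⟩ := hNadd _ _ _ hN
  have hσ0 : σ ≠ 0 := by rcases hσ with rfl | rfl <;> norm_num
  have hτ0 : τ ≠ 0 := by rcases hτ with rfl | rfl <;> norm_num
  obtain ⟨d, -, hd⟩ := hpar n (hG2 n (by
    rw [hn, hc]
    simp [hk0, hσ0, hτ0, hc0, hpi.ne']))
  have hkpar : u k = (σ⁻¹ * d - τ * c) • u i := by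
    have h1 : u k = σ⁻¹ • u n - τ • u l := by
      rw [hn, inv_smul_smul₀ hσ0]; abel
    rw [h1, hd, hc]; module
  rw [hkpar] at hk0
  simp only [map_smul, LinearMap.smul_apply, smul_eq_mul, mul_eq_zero, hpi.ne', or_false] at hk0
  exact hu0 k (by rw [hkpar, hk0, zero_smul])

end RootGeometry

/-- `z` lies in the centre of the subalgebra `k`. -/
def IsCentralIn {𝔤 : Type*} [LieRing 𝔤] [LieAlgebra ℝ 𝔤] (k : LieSubalgebra ℝ 𝔤) (z : 𝔤) : Prop :=
  z ∈ k ∧ ∀ a ∈ k, ⁅z, a⁆ = 0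

/-- The centre of `k` acts on `W` through the functional `B u`, with `ad t` as imaginary unit,
and `u` is a positive multiple of the trace of `x ↦ ⁅x, ⁅t, x⁆⁆` over `W`. -/
structure IsRootVec {𝔤 : Type*} [LieRing 𝔤] [LieAlgebra ℝ 𝔤] (B : 𝔤 →ₗ[ℝ] 𝔤 →ₗ[ℝ] ℝ)
    (k : LieSubalgebra ℝ 𝔤) (W : Submodule ℝ 𝔤) (u t : 𝔤) : Prop where
  central_u : IsCentralIn k u
  central_t : IsCentralIn k t
  ne_zero : u ≠ 0
  sq : ∀ x ∈ W, ⁅t, ⁅t, x⁆⁆ = -x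
  act : ∀ z, IsCentralIn k z → ∀ x ∈ W, ⁅z, x⁆ = B u z • ⁅t, x⁆
  nonpos : ∀ v ∈ k, (∀ x ∈ W, B ⁅x, ⁅t, x⁆⁆ v ≤ 0) → B u v ≤ 0

section RootVec

variable {𝔤 : Type*} [LieRing 𝔤] [LieAlgebra ℝ 𝔤] {B : 𝔤 →ₗ[ℝ] 𝔤 →ₗ[ℝ] ℝ}
  {k : LieSubalgebra ℝ 𝔤} {W W₁ W₂ W₃ : Submodule ℝ 𝔤} {u t u₁ t₁ u₂ t₂ u₃ t₃ : 𝔤}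

theorem IsCentralIn.smul {z : 𝔤} (hz : IsCentralIn k z) (c : ℝ) : IsCentralIn k (c • z) :=
  ⟨k.smul_mem c hz.1, fun a ha => by rw [smul_lie, hz.2 a ha, smul_zero]⟩

theorem IsCentralIn.neg {z : 𝔤} (hz : IsCentralIn k z) : IsCentralIn k (-z) := by
  simpa using hz.smul (-1)

theorem IsCentralIn.add {y z : 𝔤} (hy : IsCentralIn k y) (hz : IsCentralIn k z) :
    IsCentralIn k (y + z) :=
  ⟨k.add_mem hy.1 hz.1, fun a ha => by rw [add_lie, hy.2 a ha, hz.2 a ha, add_zero]⟩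

theorem IsCentralIn.sub {y z : 𝔤} (hy : IsCentralIn k y) (hz : IsCentralIn k z) :
    IsCentralIn k (y - z) := by
  simpa [sub_eq_add_neg] using hy.add hz.neg

theorem IsCentralIn.lie_comm {z a : 𝔤} (hz : IsCentralIn k z) (ha : a ∈ k) (x : 𝔤) :
    ⁅z, ⁅a, x⁆⁆ = ⁅a, ⁅z, x⁆⁆ := by
  rw [leibniz_lie, hz.2 a ha, zero_lie, zero_add]

theorem IsRootVec.neg (h : IsRootVec B k W u t) : IsRootVec B k W (-u) (-t) where
  central_u := h.central_u.neg
  central_t := h.central_t.neg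
  ne_zero := neg_ne_zero.2 h.ne_zero
  sq x hx := by rw [neg_lie, neg_lie, lie_neg, neg_neg, h.sq x hx]
  act z hz x hx := by
    rw [neg_lie, map_neg, LinearMap.neg_apply, neg_smul_neg, h.act z hz x hx]
  nonpos v hv hx := by
    have := h.nonpos (-v) (k.neg_mem hv) fun x hxW => by
      have := hx x hxW
      rwa [neg_lie, lie_neg, map_neg, LinearMap.neg_apply, ← map_neg] at this
    rwa [map_neg, LinearMap.neg_apply, ← map_neg]

theorem lie_lie_self_mem (hcent : ∀ x, (∀ z, IsCentralIn k z → ⁅z, x⁆ = 0) → x ∈ k)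
    {c : 𝔤 → ℝ} (hsq : ∀ x ∈ W, ⁅t, ⁅t, x⁆⁆ = -x) (ht : ∀ x ∈ W, ⁅t, x⁆ ∈ W)
    (hc : ∀ z, IsCentralIn k z → ∀ x ∈ W, ⁅z, x⁆ = c z • ⁅t, x⁆) {x : 𝔤} (hx : x ∈ W) :
    ⁅x, ⁅t, x⁆⁆ ∈ k := by
  refine hcent _ fun z hz => ?_
  rw [leibniz_lie, hc z hz x hx, hc z hz _ (ht x hx), hsq x hx]
  simp

theorem AdIrreducible.exists_isRootVec [FiniteDimensional ℝ 𝔤] (hB : IsInvInner B)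
    (hW : AdIrreducible k W) (hcent : ∀ x, (∀ z, IsCentralIn k z → ⁅z, x⁆ = 0) → x ∈ k)
    (hWk : ∀ x ∈ W, x ∈ k → x = 0) : ∃ u t, IsRootVec B k W u t := by
  have hscal : ∀ z z', IsCentralIn k z → IsCentralIn k z' →
      ∃ c : ℝ, ∀ x ∈ W, ⁅z, ⁅z', x⁆⁆ = c • x := by
    intro z z' hz hz'
    refine AdIrreducible.exists_scalar hB hW (A := LieAlgebra.ad ℝ 𝔤 z ∘ₗ LieAlgebra.ad ℝ 𝔤 z')
      (fun x hx => hW.1 z hz.1 _ (hW.1 z' hz'.1 x hx)) (fun x _ y _ => ?_) (fun a ha x _ => ?_)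
    · simp [hB.inv_left, hz.lie_comm hz'.1]
    · simp [hz'.lie_comm ha, hz.lie_comm ha]
  obtain ⟨x₀, hx₀, hx₀0⟩ := (Submodule.ne_bot_iff W).1 hW.2.1
  obtain ⟨z₀, hz₀, hzx⟩ : ∃ z, IsCentralIn k z ∧ ⁅z, x₀⁆ ≠ 0 := by
    by_contra! h
    exact hx₀0 (hWk x₀ hx₀ (hcent x₀ h))
  obtain ⟨c₀, hc₀⟩ := hscal z₀ z₀ hz₀ hz₀
  have hc₀neg : 0 < -c₀ := by
    have h1 : B ⁅z₀, x₀⁆ ⁅z₀, x₀⁆ = -c₀ * B x₀ x₀ := by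
      rw [hB.inv_left, hc₀ x₀ hx₀]; simp
    have h2 := hB.pos _ hzx
    rw [h1] at h2
    exact pos_of_mul_pos_left h2 (hB.nonneg x₀)
  set t : 𝔤 := (√(-c₀))⁻¹ • z₀ with ht
  have htc : IsCentralIn k t := hz₀.smul _
  have hsq : ∀ x ∈ W, ⁅t, ⁅t, x⁆⁆ = -x := by
    intro x hx
    rw [ht, smul_lie, smul_lie, lie_smul, hc₀ x hx, smul_smul, smul_smul, ← mul_inv,
      Real.mul_self_sqrt hc₀neg.le, ← neg_one_smul ℝ x]
    congr 1
    have : c₀ ≠ 0 := by linarith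
    field_simp
  have hact : ∀ z, ∃ c : ℝ, IsCentralIn k z → ∀ x ∈ W, ⁅z, x⁆ = c • ⁅t, x⁆ := by
    intro z
    by_cases hz : IsCentralIn k z
    · obtain ⟨c, hc⟩ := hscal z t hz htc
      refine ⟨-c, fun _ x hx => ?_⟩
      have h := hc _ (hW.1 t htc.1 x hx)
      rw [hsq x hx, lie_neg] at h
      rw [neg_smul, ← h, neg_neg]
    · exact ⟨0, fun h => absurd h hz⟩
  choose c hc using hact
  obtain ⟨n, b, hbW, hb1, hb⟩ := hB.exists_orthonormal W
  have hn : (0 : ℝ) < n := by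
    rcases Nat.eq_zero_or_pos n with rfl | h
    · exact absurd (by simpa using hb x₀ hx₀) hx₀0
    · exact_mod_cast h
  set u' : 𝔤 := ∑ i, ⁅b i, ⁅t, b i⁆⁆ with hu'
  have htW : ∀ x ∈ W, ⁅t, x⁆ ∈ W := hW.1 t htc.1
  have hu'k : u' ∈ k := k.sum_mem fun i _ => lie_lie_self_mem hcent hsq htW hc (hbW i)
  have hu'z : ∀ z, IsCentralIn k z → B u' z = n * c z := by
    intro z hz
    have h1 : ∀ i, B ⁅b i, ⁅t, b i⁆⁆ z = c z := by
      intro i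
      rw [hB.inv, ← lie_skew, map_neg, ← hB.inv_left, hc z hz _ (hbW i), map_smul,
        LinearMap.smul_apply, hB.inv_left, hsq _ (hbW i), map_neg, neg_neg, hb1, smul_eq_mul,
        mul_one]
    simp [hu', h1]
  have hu'c : IsCentralIn k u' := by
    refine ⟨hu'k, fun a ha => ?_⟩
    rw [← lie_skew, neg_eq_zero]
    set M : Fin n → Fin n → ℝ := fun j i => B (b j) ⁅a, b i⁆ with hM
    have hMskew : ∀ i j, M i j = -M j i := by
      intro i j
      simp only [hM]
      rw [hB.symm, hB.inv_left]
    set F : Fin n → Fin n → 𝔤 := fun j i => ⁅b j, ⁅t, b i⁆⁆ + ⁅b i, ⁅t, b j⁆⁆ with hF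
    have hsum : ⁅a, u'⁆ = ∑ i, ∑ j, M j i • F j i := by
      rw [hu', lie_sum]
      refine Finset.sum_congr rfl fun i _ => ?_
      rw [leibniz_lie, ← htc.lie_comm ha, hb _ (hW.1 a ha _ (hbW i))]
      simp only [sum_lie, lie_sum, hF, hM, smul_add, smul_lie, lie_smul,
        Finset.sum_add_distrib]
    have hneg : ⁅a, u'⁆ = -⁅a, u'⁆ := by
      conv_lhs => rw [hsum, Finset.sum_comm]
      rw [hsum, ← Finset.sum_neg_distrib]
      refine Finset.sum_congr rfl fun i _ => ?_
      rw [← Finset.sum_neg_distrib]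
      refine Finset.sum_congr rfl fun j _ => ?_
      rw [hMskew, neg_smul]
      simp only [hF, add_comm]
    have h2 : (2 : ℝ) • ⁅a, u'⁆ = 0 := by
      rw [two_smul]
      nth_rewrite 1 [hneg]
      exact neg_add_cancel _
    exact (smul_eq_zero.1 h2).resolve_left two_ne_zero
  refine ⟨(n : ℝ)⁻¹ • u', t, hu'c.smul _, htc, ?_, hsq, fun z hz x hx => ?_, fun v hv h => ?_⟩
  · intro h0
    have h1 : c z₀ = 0 := by
      have := hu'z z₀ hz₀
      rw [(smul_eq_zero.1 h0).resolve_left (inv_ne_zero hn.ne')] at this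
      simpa [hn.ne'] using this.symm
    exact hzx (by rw [hc z₀ hz₀ x₀ hx₀, h1, zero_smul])
  · rw [map_smul, LinearMap.smul_apply, hu'z z hz, smul_eq_mul, inv_mul_cancel_left₀ hn.ne',
      hc z hz x hx]
  · rw [map_smul, LinearMap.smul_apply, smul_eq_mul]
    refine mul_nonpos_of_nonneg_of_nonpos (inv_nonneg.2 hn.le) ?_
    rw [hu', map_sum, LinearMap.sum_apply]
    exact Finset.sum_nonpos fun i _ => h _ (hbW i)

theorem IsRootVec.lie_lie_self_mem (h : IsRootVec B k W u t)
    (hcent : ∀ x, (∀ z, IsCentralIn k z → ⁅z, x⁆ = 0) → x ∈ k) (hW : AdInvariant k W)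
    {x : 𝔤} (hx : x ∈ W) : ⁅x, ⁅t, x⁆⁆ ∈ k :=
  _root_.lie_lie_self_mem hcent h.sq (hW t h.central_t.1) h.act hx

theorem IsInvInner.eq_or_eq_neg_of_sq_eq (hB : IsInvInner B) {a b : 𝔤}
    (ha : IsCentralIn k a) (hb : IsCentralIn k b)
    (h : ∀ z, IsCentralIn k z → B a z ^ 2 = B b z ^ 2) : a = b ∨ a = -b := by
  have ha' := h _ ha
  have hb' := h _ hb
  rw [hB.symm b a] at ha'
  have hab : B a a = B b b :=
    (sq_eq_sq₀ (hB.nonneg a) (hB.nonneg b)).1 (ha'.trans hb')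
  rcases sq_eq_sq_iff_eq_or_eq_neg.1 hb' with h1 | h1
  · left
    rw [← sub_eq_zero]
    apply hB.eq_zero
    simp only [map_sub, LinearMap.sub_apply, hB.symm b a]
    linarith
  · right
    rw [← sub_eq_zero, sub_neg_eq_add]
    apply hB.eq_zero
    simp only [map_add, LinearMap.add_apply, hB.symm b a]
    linarith

theorem IsRootVec.eq_of_pairing_ne_zero (hB : IsInvInner B)
    (h₁ : IsRootVec B k W₁ u₁ t₁) (h₂ : IsRootVec B k W₂ u₂ t₂) (h₃ : IsRootVec B k W₃ u₃ t₃)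
    (hW₁ : AdInvariant k W₁) (hW₂ : AdInvariant k W₂) (hW₃ : AdInvariant k W₃)
    {x y w : 𝔤} (hx : x ∈ W₁) (hy : y ∈ W₂) (hw : w ∈ W₃)
    (h : B (⁅x, y⁆ + ⁅⁅t₁, x⁆, ⁅t₂, y⁆⁆) w ≠ 0) :
    ∃ σ : ℝ, (σ = 1 ∨ σ = -1) ∧ u₃ = σ • (u₁ - u₂) := by
  suffices u₃ = u₁ - u₂ ∨ u₃ = -(u₁ - u₂) by
    rcases this with h | h
    · exact ⟨1, Or.inl rfl, by rw [h, one_smul]⟩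
    · exact ⟨-1, Or.inr rfl, by rw [h, neg_one_smul]⟩
  refine hB.eq_or_eq_neg_of_sq_eq h₃.central_u (h₁.central_u.sub h₂.central_u) fun z hz => ?_
  set q := ⁅x, y⁆ + ⁅⁅t₁, x⁆, ⁅t₂, y⁆⁆ with hq
  have hx' := hW₁ t₁ h₁.central_t.1 x hx
  have hy' := hW₂ t₂ h₂.central_t.1 y hy
  have hw' := hW₃ t₃ h₃.central_t.1 w hw
  have h1 : ⁅z, ⁅z, q⁆⁆ = -(B (u₁ - u₂) z ^ 2) • q := by
    have hzx := h₁.act z hz x hx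
    have hzy := h₂.act z hz y hy
    have hzx' : ⁅z, ⁅t₁, x⁆⁆ = -B u₁ z • x := by rw [h₁.act z hz _ hx', h₁.sq x hx]; module
    have hzy' : ⁅z, ⁅t₂, y⁆⁆ = -B u₂ z • y := by rw [h₂.act z hz _ hy', h₂.sq y hy]; module
    have e1 : ⁅z, q⁆ = B (u₁ - u₂) z • (⁅⁅t₁, x⁆, y⁆ - ⁅x, ⁅t₂, y⁆⁆) := by
      rw [hq, lie_add, leibniz_lie z x y, leibniz_lie z ⁅t₁, x⁆, hzx, hzy, hzx', hzy', map_sub,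
        LinearMap.sub_apply]
      simp only [smul_lie, lie_smul]
      module
    have e2 : ⁅z, ⁅⁅t₁, x⁆, y⁆ - ⁅x, ⁅t₂, y⁆⁆⁆ = -B (u₁ - u₂) z • q := by
      rw [hq, lie_sub, leibniz_lie z x, leibniz_lie z ⁅t₁, x⁆, hzx, hzy, hzx', hzy', map_sub,
        LinearMap.sub_apply]
      simp only [smul_lie, lie_smul]
      module
    rw [e1, lie_smul, e2]
    module
  have h2 : ⁅z, ⁅z, w⁆⁆ = -(B u₃ z ^ 2) • w := by
    rw [h₃.act z hz w hw, lie_smul, h₃.act z hz _ hw', h₃.sq w hw]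
    module
  have h3 : B ⁅z, ⁅z, q⁆⁆ w = B q ⁅z, ⁅z, w⁆⁆ := by
    rw [hB.inv_left, hB.inv_left, neg_neg]
  rw [h1, h2] at h3
  simp only [map_smul, LinearMap.smul_apply, smul_eq_mul, neg_mul, neg_inj] at h3
  exact (mul_right_cancel₀ h h3).symm

theorem IsRootVec.exists_lie_add_ne_zero (hB : IsInvInner B)
    (h₁ : IsRootVec B k W₁ u₁ t₁) (h₂ : IsRootVec B k W₂ u₂ t₂)
    (hcent : ∀ x, (∀ z, IsCentralIn k z → ⁅z, x⁆ = 0) → x ∈ k)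
    (hW₁ : AdInvariant k W₁) (hW₂ : AdInvariant k W₂) (hW₂0 : W₂ ≠ ⊥) (hpos : 0 < B u₁ u₂) :
    ∃ x ∈ W₁, ∃ y ∈ W₂, ⁅x, y⁆ + ⁅⁅t₁, x⁆, ⁅t₂, y⁆⁆ ≠ 0 := by
  by_contra! hq
  obtain ⟨y, hy, hy0⟩ := (Submodule.ne_bot_iff W₂).1 hW₂0
  have hy' := hW₂ t₂ h₂.central_t.1 y hy
  have h := h₁.nonpos _ (h₂.lie_lie_self_mem hcent hW₂ hy) fun x hx => by
    have hx' := hW₁ t₁ h₁.central_t.1 x hx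
    have e1 : ⁅⁅t₁, x⁆, ⁅t₂, y⁆⁆ = -⁅x, y⁆ := eq_neg_of_add_eq_zero_right (hq x hx y hy)
    have e2 : ⁅x, ⁅t₂, y⁆⁆ = ⁅⁅t₁, x⁆, y⁆ := by
      have := hq _ hx' y hy
      rw [h₁.sq x hx, neg_lie] at this
      exact (eq_of_sub_eq_zero (by rw [sub_eq_add_neg]; exact this)).symm
    have key : B ⁅x, ⁅t₁, x⁆⁆ ⁅y, ⁅t₂, y⁆⁆ =
        B ⁅x, y⁆ ⁅⁅t₁, x⁆, ⁅t₂, y⁆⁆ - B ⁅⁅t₁, x⁆, y⁆ ⁅x, ⁅t₂, y⁆⁆ := by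
      rw [hB.inv x, leibniz_lie ⁅t₁, x⁆ y, map_add, ← hB.inv x y,
        ← lie_skew ⁅⁅t₁, x⁆, y⁆ ⁅t₂, y⁆, map_neg, ← hB.inv x ⁅t₂, y⁆, hB.symm ⁅⁅t₁, x⁆, y⁆]
      ring
    rw [key, e1, e2, map_neg]
    linarith [hB.nonneg ⁅x, y⁆, hB.nonneg ⁅⁅t₁, x⁆, y⁆]
  have hty : B ⁅t₂, y⁆ ⁅t₂, y⁆ = B y y := by
    rw [hB.inv_left, h₂.sq y hy, map_neg, neg_neg]
  rw [← hB.inv, h₂.act _ h₁.central_u y hy, map_smul, LinearMap.smul_apply, hty, smul_eq_mul,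
    hB.symm] at h
  exact absurd h (not_le.2 (mul_pos hpos (hB.pos y hy0)))

end RootVec

section Summands

variable {𝔤 ι : Type*} [LieRing 𝔤] [LieAlgebra ℝ 𝔤] {B : 𝔤 →ₗ[ℝ] 𝔤 →ₗ[ℝ] ℝ}
  {k : LieSubalgebra ℝ 𝔤} {m : ι → Submodule ℝ 𝔤}

theorem IsInvInner.eq_zero_of_orthogonal (hB : IsInvInner B)
    (htop : k.toSubmodule ⊔ ⨆ i, m i = ⊤) {q : 𝔤} (hk : ∀ a ∈ k, B q a = 0)
    (hm : ∀ i, ∀ w ∈ m i, B q w = 0) : q = 0 := by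
  have h : (⊤ : Submodule ℝ 𝔤) ≤ LinearMap.ker (B q) := by
    rw [← htop]
    exact sup_le hk (iSup_le hm)
  exact hB.eq_zero (h (Submodule.mem_top (x := q)))

theorem IsInvInner.mem_of_orthogonal (hB : IsInvInner B)
    (horth : ∀ i j, i ≠ j → ∀ x ∈ m i, ∀ y ∈ m j, B x y = 0) {x : 𝔤} (hx : x ∈ ⨆ i, m i) {i : ι}
    (hxj : ∀ j, j ≠ i → ∀ w ∈ m j, B x w = 0) : x ∈ m i := by
  rw [iSup_split_single m i] at hx
  obtain ⟨a, ha, r, hr, rfl⟩ := Submodule.mem_sup.1 hx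
  have hxr : B (a + r) r = 0 := by
    have h : ⨆ (j) (_ : j ≠ i), m j ≤ LinearMap.ker (B (a + r)) := iSup₂_le hxj
    exact h hr
  have har : B a r = 0 := by
    have h : ⨆ (j) (_ : j ≠ i), m j ≤ LinearMap.ker (B a) :=
      iSup₂_le fun j hj w hw => horth i j hj.symm a ha w hw
    exact h hr
  rw [map_add, LinearMap.add_apply, har, zero_add] at hxr
  rwa [hB.eq_zero hxr, add_zero]

/-- In a simple Lie algebra the summands cannot be split into two commuting families. -/
theorem IsInvInner.exists_lie_ne_zero [LieAlgebra.IsSimple ℝ 𝔤] (hB : IsInvInner B)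
    (hinv : ∀ i, AdInvariant k (m i)) (hne : ∀ i, m i ≠ ⊥)
    (horth : ∀ i j, i ≠ j → ∀ x ∈ m i, ∀ y ∈ m j, B x y = 0)
    (htop : k.toSubmodule ⊔ ⨆ i, m i = ⊤) {I : Set ι} (hI : I.Nonempty) (hI' : Iᶜ.Nonempty) :
    ∃ i ∈ I, ∃ j ∉ I, ∃ x ∈ m i, ∃ y ∈ m j, ⁅x, y⁆ ≠ 0 := by
  by_contra! hcomm
  let C : LieIdeal ℝ 𝔤 :=
    { carrier := {x | ∀ i ∈ I, ∀ w ∈ m i, ⁅x, w⁆ = 0 ∧ B x w = 0}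
      zero_mem' := fun i _ w _ => by simp
      add_mem' := fun {x y} hx hy i hi w hw => by
        simp [hx i hi w hw, hy i hi w hw]
      smul_mem' := fun c x hx i hi w hw => by
        simp [hx i hi w hw]
      lie_mem := fun {l x} hx i hi w hw => by
        refine ⟨?_, by rw [hB.inv, (hx i hi w hw).1, map_zero]⟩
        have hflip : ∀ l, ⁅⁅l, x⁆, w⁆ = ⁅w, ⁅x, l⁆⁆ := fun l => by
          rw [← lie_skew, ← lie_skew l x, lie_neg, neg_neg]
        have hl : (⊤ : Submodule ℝ 𝔤) ≤
            LinearMap.ker (LieAlgebra.ad ℝ 𝔤 w ∘ₗ LieAlgebra.ad ℝ 𝔤 x) := by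
          rw [← htop]
          refine sup_le (fun l hl => ?_) (iSup_le fun j l hl => ?_)
          · have h : ⁅⁅l, x⁆, w⁆ = 0 := by
              rw [lie_lie, (hx i hi w hw).1, (hx i hi _ (hinv i l hl w hw)).1, lie_zero, sub_zero]
            exact (hflip l).symm.trans h
          · have h : ⁅⁅l, x⁆, w⁆ = 0 := by
              by_cases hj : j ∈ I
              · rw [← lie_skew l x, (hx j hj l hl).1, neg_zero, zero_lie]
              · rw [lie_lie, (hx i hi w hw).1, ← lie_skew l w, hcomm i hi j hj w hw l hl]
                simp
            exact (hflip l).symm.trans h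
        exact (hflip l).trans (hl (Submodule.mem_top (x := l))) }
  obtain ⟨i, hi⟩ := hI
  obtain ⟨j, hj⟩ := hI'
  rcases LieAlgebra.IsSimple.eq_bot_or_eq_top C with h | h
  · obtain ⟨y, hy, hy0⟩ := (Submodule.ne_bot_iff _).1 (hne j)
    have hyC : y ∈ C := fun i hi w hw =>
      ⟨by rw [← lie_skew, hcomm i hi j hj w hw y hy, neg_zero],
        horth j i (fun h => hj (h ▸ hi)) y hy w hw⟩
    rw [h] at hyC
    exact hy0 (by simpa using hyC)
  · obtain ⟨x, hx, hx0⟩ := (Submodule.ne_bot_iff _).1 (hne i)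
    have hxC : x ∈ C := h ▸ LieSubmodule.mem_top x
    exact hx0 (hB.eq_zero (hxC i hi x hx).2)

theorem IsRootVec.constant_of_lie_orthogonal [LieAlgebra.IsSimple ℝ 𝔤] (hB : IsInvInner B)
    (hinv : ∀ i, AdInvariant k (m i)) (hne : ∀ i, m i ≠ ⊥)
    (horth : ∀ i j, i ≠ j → ∀ x ∈ m i, ∀ y ∈ m j, B x y = 0)
    (htop : k.toSubmodule ⊔ ⨆ i, m i = ⊤)
    (hcent : ∀ x, (∀ z, IsCentralIn k z → ⁅z, x⁆ = 0) → x ∈ k)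
    {u t : ι → 𝔤} (hroot : ∀ i, IsRootVec B k (m i) (u i) (t i)) (lam : ι → ℝ)
    (hlam : ∀ i j l, lam i ≠ lam j → l ≠ i → l ≠ j →
      ∀ x ∈ m i, ∀ y ∈ m j, ∀ w ∈ m l, B ⁅x, y⁆ w = 0)
    (hthree : ∀ i j : ι, ∃ l, l ≠ i ∧ l ≠ j) (i j : ι) : lam i = lam j := by
  have hperp : ∀ i j, i ≠ j → ∀ x ∈ m i, ∀ y ∈ m j, ∀ a ∈ k, B ⁅x, y⁆ a = 0 := by
    intro i j hij x hx y hy a ha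
    rw [hB.inv, ← lie_skew, map_neg, horth i j hij x hx _ (hinv j a ha y hy), neg_zero]
  have hdetect : ∀ i j, i ≠ j → ∀ t₁ t₂, IsCentralIn k t₁ → IsCentralIn k t₂ →
      ∀ x ∈ m i, ∀ y ∈ m j, ⁅x, y⁆ + ⁅⁅t₁, x⁆, ⁅t₂, y⁆⁆ ≠ 0 →
      ∃ l, (∃ x ∈ m i, ∃ y ∈ m j, ∃ w ∈ m l, B ⁅x, y⁆ w ≠ 0) ∧
        ∃ w ∈ m l, B (⁅x, y⁆ + ⁅⁅t₁, x⁆, ⁅t₂, y⁆⁆) w ≠ 0 := by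
    intro i j hij t₁ t₂ ht₁ ht₂ x hx y hy hq
    have hx' := hinv i t₁ ht₁.1 x hx
    have hy' := hinv j t₂ ht₂.1 y hy
    obtain ⟨l, w, hw, hqw⟩ : ∃ l, ∃ w ∈ m l, B (⁅x, y⁆ + ⁅⁅t₁, x⁆, ⁅t₂, y⁆⁆) w ≠ 0 := by
      by_contra! h
      refine hq (hB.eq_zero_of_orthogonal htop (fun a ha => ?_) h)
      rw [map_add, LinearMap.add_apply, hperp i j hij x hx y hy a ha,
        hperp i j hij _ hx' _ hy' a ha, add_zero]
    refine ⟨l, ?_, w, hw, hqw⟩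
    by_cases h : B ⁅x, y⁆ w = 0
    · refine ⟨_, hx', _, hy', w, hw, ?_⟩
      rwa [map_add, LinearMap.add_apply, h, zero_add] at hqw
    · exact ⟨x, hx, y, hy, w, hw, h⟩
  refine constant_of_indecomposable_rootSystem hB.pos u
    (fun i j l => ∃ x ∈ m i, ∃ y ∈ m j, ∃ w ∈ m l, B ⁅x, y⁆ w ≠ 0) lam (fun i => (hroot i).ne_zero)
    ?_ ?_ ?_ ?_ ?_ ?_ hthree i j
  · rintro i j l ⟨x, hx, y, hy, w, hw, h⟩
    refine ⟨y, hy, x, hx, w, hw, ?_⟩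
    rwa [← lie_skew, map_neg, LinearMap.neg_apply, neg_ne_zero]
  · rintro i j l ⟨x, hx, y, hy, w, hw, h⟩
    refine ⟨x, hx, w, hw, y, hy, ?_⟩
    rwa [hB.inv_left, hB.symm, neg_ne_zero]
  · rintro i j l ⟨x, hx, y, hy, w, hw, h⟩
    by_cases hq : B (⁅x, y⁆ + ⁅⁅t i, x⁆, ⁅t j, y⁆⁆) w = 0
    · have hp : B (⁅x, y⁆ + ⁅⁅t i, x⁆, ⁅-t j, y⁆⁆) w ≠ 0 := by
        intro h0
        rw [map_add, LinearMap.add_apply] at hq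
        rw [neg_lie, lie_neg, map_add, map_neg, LinearMap.add_apply, LinearMap.neg_apply] at h0
        exact h (by linarith)
      obtain ⟨σ, hσ, hu⟩ := (hroot i).eq_of_pairing_ne_zero hB (hroot j).neg (hroot l)
        (hinv i) (hinv j) (hinv l) hx hy hw hp
      exact ⟨σ, 1, hσ, Or.inl rfl, by rw [hu]; module⟩
    · obtain ⟨σ, hσ, hu⟩ := (hroot i).eq_of_pairing_ne_zero hB (hroot j) (hroot l)
        (hinv i) (hinv j) (hinv l) hx hy hw hq
      exact ⟨σ, -1, hσ, Or.inr rfl, by rw [hu]; module⟩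
  · intro i j hij h
    rcases lt_or_gt_of_ne h with h | h
    · obtain ⟨x, hx, y, hy, hq⟩ := (hroot i).exists_lie_add_ne_zero hB (hroot j).neg hcent
        (hinv i) (hinv j) (hne j) (by rw [map_neg]; linarith)
      obtain ⟨l, hN, w, hw, hqw⟩ := hdetect i j hij _ _ (hroot i).central_t (hroot j).neg.central_t
        x hx y hy hq
      obtain ⟨σ, hσ, hu⟩ := (hroot i).eq_of_pairing_ne_zero hB (hroot j).neg (hroot l)
        (hinv i) (hinv j) (hinv l) hx hy hw hqw
      exact ⟨l, hN, σ, 1, hσ, Or.inl rfl, by linarith, by rw [hu]; module⟩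
    · obtain ⟨x, hx, y, hy, hq⟩ := (hroot i).exists_lie_add_ne_zero hB (hroot j) hcent
        (hinv i) (hinv j) (hne j) h
      obtain ⟨l, hN, w, hw, hqw⟩ := hdetect i j hij _ _ (hroot i).central_t (hroot j).central_t
        x hx y hy hq
      obtain ⟨σ, hσ, hu⟩ := (hroot i).eq_of_pairing_ne_zero hB (hroot j) (hroot l)
        (hinv i) (hinv j) (hinv l) hx hy hw hqw
      exact ⟨l, hN, σ, -1, hσ, Or.inr rfl, by linarith, by rw [hu]; module⟩
  · rintro i j l hij ⟨x, hx, y, hy, w, hw, h⟩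
    by_contra! hl
    exact h (hlam i j l hij hl.1 hl.2 x hx y hy w hw)
  · intro I hI hI'
    obtain ⟨i, hi, j, hj, x, hx, y, hy, h⟩ := hB.exists_lie_ne_zero hinv hne horth htop hI hI'
    refine ⟨i, hi, j, hj, ?_⟩
    by_contra! h0
    exact h (hB.eq_zero_of_orthogonal htop
      (hperp i j (fun e => hj (e ▸ hi)) x hx y hy) fun l w hw => h0 l x hx y hy w hw)

/-- The associated operator of a g.o. metric commutes with the larger isotropy algebra `k`. -/
theorem IsGOMetric.equivariant [FiniteDimensional ℝ 𝔤] (hB : IsInvInner B)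
    {k₁ : LieSubalgebra ℝ 𝔤} {n : Submodule ℝ 𝔤} {Λ : 𝔤 →ₗ[ℝ] 𝔤} (hgo : IsGOMetric k₁ n Λ)
    (hk : k₁ ≤ k) (hder : ∀ x ∈ k, ∀ y ∈ k, ⁅x, y⁆ ∈ k₁) (hn : AdInvariant k n)
    (hΛn : ∀ x ∈ n, Λ x ∈ n) (hsym : ∀ x ∈ n, ∀ y ∈ n, B (Λ x) y = B x (Λ y))
    (hequiv : ∀ a ∈ k₁, ∀ x ∈ n, Λ ⁅a, x⁆ = ⁅a, Λ x⁆) :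
    ∀ a ∈ k, ∀ x ∈ n, Λ ⁅a, x⁆ = ⁅a, Λ x⁆ := by
  obtain ⟨P, hPk, hP⟩ := hB.exists_proj k₁.toSubmodule
  intro a ha y hy
  set z := a - P a with hz
  have hzk : z ∈ k := k.sub_mem ha (hk (hPk a))
  have hzorth : ∀ b ∈ k₁, B b z = 0 := fun b hb => by
    rw [hz, hB.symm, LinearMap.map_sub₂, hP a b hb, sub_self]
  have hzcomm : ∀ b ∈ k₁, ⁅b, z⁆ = 0 := fun b hb => by
    apply hB.eq_zero
    rw [hB.inv_left, hB.symm, hB.symm]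
    have h := hzorth _ (hder b (hk hb) _ (hk (hder b (hk hb) z hzk)))
    rw [hB.symm, h, neg_zero]
  have hdiag : ∀ x ∈ n, B ⁅x, Λ x⁆ z = 0 := by
    intro x hx
    obtain ⟨b, hb, h⟩ := hgo x hx
    have h0 := hzorth _ h
    rwa [add_lie, map_add, LinearMap.add_apply, ← lie_skew b, map_neg, LinearMap.neg_apply, hB.inv,
      hzcomm b hb, map_zero, neg_zero, zero_add] at h0
  have hzy : Λ ⁅z, y⁆ = ⁅z, Λ y⁆ := by
    have hmem : Λ ⁅z, y⁆ - ⁅z, Λ y⁆ ∈ n :=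
      n.sub_mem (hΛn _ (hn z hzk y hy)) (hn z hzk _ (hΛn y hy))
    rw [← sub_eq_zero]
    apply hB.eq_zero
    set x := Λ ⁅z, y⁆ - ⁅z, Λ y⁆ with hx
    have h := hdiag _ (n.add_mem hmem hy)
    simp only [map_add, lie_add, add_lie, LinearMap.add_apply, hdiag x hmem, hdiag y hy] at h
    have e1 : B ⁅x, Λ y⁆ z = -B x ⁅z, Λ y⁆ := by
      rw [hB.inv, ← lie_skew, map_neg]
    have e2 : B ⁅y, Λ x⁆ z = B x (Λ ⁅z, y⁆) := by
      rw [hB.inv_left, ← lie_skew, map_neg, neg_neg, hsym x hmem _ (hn z hzk y hy)]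
    nth_rewrite 2 [hx]
    rw [map_sub]
    linarith
  have hsplit : a = P a + z := by rw [hz]; abel
  rw [hsplit, add_lie, add_lie, map_add, hzy, hequiv _ (hPk a) y hy]

end Summands

/-- **Theorem 1** (Arvanitoyeorgos–Wang–Zhao).
Let `G/K` be a generalized flag manifold whose isotropy representation decomposes into
`s ≥ 3` pairwise inequivalent irreducible `Ad(K)`-submodules `𝔪 = 𝔪₁ ⊕ ⋯ ⊕ 𝔪ₛ`, and let
`G/K₁` be the corresponding `M`-space.  If `(G/K₁, g)` is a g.o. space then the associated
operator `Λ` of `g` is a positive scalar `λ` on `𝔪 = 𝔪₁ ⊕ ⋯ ⊕ 𝔪ₛ`, i.e.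
`g = Λ|_𝔰 + λ B(·,·)|_{𝔪₁ ⊕ ⋯ ⊕ 𝔪ₛ}`. -/
theorem goMetric_on_Mspace_of_flag_with_at_least_three_summands
    {𝔤 : Type*} [LieRing 𝔤] [LieAlgebra ℝ 𝔤] [FiniteDimensional ℝ 𝔤]
    -- `G` is a compact simple Lie group: `𝔤` is simple with negative definite Killing form
    [LieAlgebra.IsSimple ℝ 𝔤]
    (hcompact : ∀ x : 𝔤, x ≠ 0 → killingForm ℝ 𝔤 x x < 0)
    (𝔨 𝔨₁ 𝔰 : LieSubalgebra ℝ 𝔤)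
    -- `S` is a torus in `G` and `K = C(S)` is its centralizer
    (h𝔰ab : ∀ x ∈ 𝔰, ∀ y ∈ 𝔰, ⁅x, y⁆ = (0 : 𝔤))
    (h𝔨cent : ∀ x : 𝔤, x ∈ 𝔨 ↔ ∀ s ∈ 𝔰, ⁅s, x⁆ = 0)
    -- `K = S × K₁`, `K₁` being the semisimple part of `K`
    (h𝔰𝔨 : 𝔰 ≤ 𝔨) (h𝔨₁𝔨 : 𝔨₁ ≤ 𝔨)
    (h𝔨sum : 𝔰.toSubmodule ⊔ 𝔨₁.toSubmodule = 𝔨.toSubmodule)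
    (h𝔨disj : Disjoint 𝔰.toSubmodule 𝔨₁.toSubmodule)
    (h𝔰𝔨₁ : ∀ s ∈ 𝔰, ∀ k ∈ 𝔨₁, ⁅s, k⁆ = (0 : 𝔤))
    (hder : ∀ x ∈ 𝔨, ∀ y ∈ 𝔨, ⁅x, y⁆ ∈ 𝔨₁)
    -- the `B`-orthogonal reductive decomposition `𝔤 = 𝔨 ⊕ 𝔪`, where `B = -Killing form`
    (𝔪 : Submodule ℝ 𝔤)
    (h𝔪compl : IsCompl 𝔨.toSubmodule 𝔪)
    (h𝔪orth : ∀ x ∈ 𝔨, ∀ y ∈ 𝔪, killingForm ℝ 𝔤 x y = 0)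
    (h𝔪inv : AdInvariant 𝔨 𝔪)
    -- the decomposition `𝔪 = 𝔪₁ ⊕ ⋯ ⊕ 𝔪ₛ` with `s ≥ 3`, `B`-orthogonal, into pairwise
    -- inequivalent irreducible `Ad(K)`-submodules
    (s : ℕ) (hs : 3 ≤ s) (m : Fin s → Submodule ℝ 𝔤)
    (hmsub : ∀ i, m i ≤ 𝔪)
    (hmsum : ⨆ i, m i = 𝔪)
    (hmorth : ∀ i j, i ≠ j → ∀ x ∈ m i, ∀ y ∈ m j, killingForm ℝ 𝔤 x y = 0)
    (hmirr : ∀ i, AdIrreducible 𝔨 (m i))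
    (hmineq : ∀ i j, i ≠ j → ¬ AdEquiv 𝔨 (m i) (m j))
    -- `Λ` is the associated operator of the `G`-invariant metric `g` on the `M`-space
    -- `G/K₁`, whose tangent space at the origin is `𝔫 = 𝔰 ⊕ 𝔪`:
    -- positive definite, symmetric w.r.t. `B = -Killing`, and `Ad(K₁)`-equivariant
    (Λ : 𝔤 →ₗ[ℝ] 𝔤)
    (hΛ𝔫 : ∀ x ∈ 𝔰.toSubmodule ⊔ 𝔪, Λ x ∈ 𝔰.toSubmodule ⊔ 𝔪)
    (hΛsym : ∀ x ∈ 𝔰.toSubmodule ⊔ 𝔪, ∀ y ∈ 𝔰.toSubmodule ⊔ 𝔪,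
      killingForm ℝ 𝔤 (Λ x) y = killingForm ℝ 𝔤 x (Λ y))
    (hΛpos : ∀ x ∈ 𝔰.toSubmodule ⊔ 𝔪, x ≠ 0 → 0 < -(killingForm ℝ 𝔤 (Λ x) x))
    (hΛequiv : ∀ k ∈ 𝔨₁, ∀ x ∈ 𝔰.toSubmodule ⊔ 𝔪, Λ ⁅k, x⁆ = ⁅k, Λ x⁆)
    -- `(G/K₁, g)` is a g.o. space
    (hgo : IsGOMetric 𝔨₁ (𝔰.toSubmodule ⊔ 𝔪) Λ) :
    ∃ lam : ℝ, 0 < lam ∧ ∀ x ∈ 𝔪, Λ x = lam • x := by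
  set B : 𝔤 →ₗ[ℝ] 𝔤 →ₗ[ℝ] ℝ := -killingForm ℝ 𝔤
  have hBapp : ∀ x y, B x y = -killingForm ℝ 𝔤 x y := fun _ _ => rfl
  have hB : IsInvInner B :=
    { symm := fun x y => by rw [hBapp, hBapp, LieModule.traceForm_comm]
      pos := fun x hx => neg_pos.2 (hcompact x hx)
      inv := fun x y z => by rw [hBapp, hBapp, LieModule.traceForm_apply_lie_apply] }
  have hcentral : ∀ z ∈ 𝔰, IsCentralIn 𝔨 z := fun z hz =>
    ⟨h𝔰𝔨 hz, fun a ha => (h𝔨cent a).1 ha z hz⟩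
  have hcent : ∀ x, (∀ z, IsCentralIn 𝔨 z → ⁅z, x⁆ = 0) → x ∈ 𝔨 := fun x hx =>
    (h𝔨cent x).2 fun z hz => hx z (hcentral z hz)
  have horth : ∀ i j, i ≠ j → ∀ x ∈ m i, ∀ y ∈ m j, B x y = 0 := fun i j hij x hx y hy => by
    rw [hBapp, hmorth i j hij x hx y hy, neg_zero]
  have hinv : ∀ i, AdInvariant 𝔨 (m i) := fun i => (hmirr i).1
  have hne : ∀ i, m i ≠ ⊥ := fun i => (hmirr i).2.1
  have htop : 𝔨.toSubmodule ⊔ ⨆ i, m i = ⊤ := by rw [hmsum, h𝔪compl.sup_eq_top]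
  have hroot : ∀ i, ∃ u t, IsRootVec B 𝔨 (m i) u t := fun i =>
    (hmirr i).exists_isRootVec hB hcent fun x hx hxk =>
      Submodule.disjoint_def.1 h𝔪compl.disjoint x hxk (hmsub i hx)
  choose u t hroot using hroot
  set 𝔫 := 𝔰.toSubmodule ⊔ 𝔪
  have h𝔨𝔫 : ∀ a ∈ 𝔨, ∀ x ∈ 𝔫, ⁅a, x⁆ ∈ 𝔪 := by
    intro a ha x hx
    obtain ⟨z, hz, y, hy, rfl⟩ := Submodule.mem_sup.1 hx
    rw [lie_add, ← lie_skew, (hcentral z hz).2 a ha, neg_zero, zero_add]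
    exact h𝔪inv a ha y hy
  have h𝔪𝔫 : 𝔪 ≤ 𝔫 := le_sup_right
  have hm𝔫 : ∀ i, m i ≤ 𝔫 := fun i => (hmsub i).trans h𝔪𝔫
  have hsym : ∀ x ∈ 𝔫, ∀ y ∈ 𝔫, B (Λ x) y = B x (Λ y) := fun x hx y hy => by
    rw [hBapp, hBapp, hΛsym x hx y hy]
  have hΛ𝔨 := hgo.equivariant hB h𝔨₁𝔨 hder (fun a ha x hx => h𝔪𝔫 (h𝔨𝔫 a ha x hx)) hΛ𝔫 hsym hΛequiv
  have hΛm : ∀ i, ∀ x ∈ m i, Λ x ∈ m i := by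
    intro i x hx
    have htk := (hroot i).central_t.1
    refine hB.mem_of_orthogonal horth ?_ fun j hj => (hmirr i).orthogonal_of_not_adEquiv hB (hmirr j)
      (hmineq i j hj.symm) (fun a ha y hy => hΛ𝔨 a ha y (hm𝔫 i hy)) x hx
    have hx' := hinv i _ htk x hx
    rw [hmsum, ← neg_neg x, ← (hroot i).sq x hx, map_neg, hΛ𝔨 _ htk _ (hm𝔫 i hx')]
    exact 𝔪.neg_mem (h𝔨𝔫 _ htk _ (hΛ𝔫 _ (hm𝔫 i hx')))
  have hscal : ∀ i, ∃ c : ℝ, ∀ x ∈ m i, Λ x = c • x := fun i =>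
    (hmirr i).exists_scalar hB (hΛm i) (fun x hx y hy => hsym x (hm𝔫 i hx) y (hm𝔫 i hy))
      fun a ha x hx => hΛ𝔨 a ha x (hm𝔫 i hx)
  choose lam hlam using hscal
  have hconst : ∀ i j, lam i = lam j := by
    refine IsRootVec.constant_of_lie_orthogonal hB hinv hne horth htop hcent hroot lam ?_ ?_
    · intro i j l hij hli hlj x hx y hy w hw
      obtain ⟨a, ha, h⟩ := hgo (x + y) (𝔫.add_mem (hm𝔫 i hx) (hm𝔫 j hy))
      have h0 : B ⁅a + (x + y), Λ (x + y)⁆ w = 0 := by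
        rw [hBapp, h𝔪orth _ (h𝔨₁𝔨 h) w (hmsub l hw), neg_zero]
      have hax : B ⁅a, x⁆ w = 0 :=
        horth i l hli.symm _ (hinv i a (h𝔨₁𝔨 ha) x hx) w hw
      have hay : B ⁅a, y⁆ w = 0 :=
        horth j l hlj.symm _ (hinv j a (h𝔨₁𝔨 ha) y hy) w hw
      have hyx : B ⁅y, x⁆ w = -B ⁅x, y⁆ w := by
        rw [← lie_skew, map_neg, LinearMap.neg_apply]
      rw [map_add, hlam i x hx, hlam j y hy] at h0
      simp only [add_lie, lie_add, lie_smul, lie_self, map_add, map_smul, LinearMap.add_apply,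
        LinearMap.smul_apply, hax, hay, hyx, smul_eq_mul, map_zero, LinearMap.zero_apply] at h0
      have h1 : (lam j - lam i) * B ⁅x, y⁆ w = 0 := by linear_combination h0
      exact (mul_eq_zero.1 h1).resolve_left (sub_ne_zero.2 hij.symm)
    · intro i j
      by_contra! h
      have hsub : (Finset.univ : Finset (Fin s)) ⊆ {i, j} := fun l _ => by
        by_cases hl : l = i
        · simp [hl]
        · simp [h l hl]
      have hcard := (Finset.card_le_card hsub).trans Finset.card_le_two
      rw [Finset.card_univ, Fintype.card_fin] at hcard
      omega
  let i₀ : Fin s := ⟨0, by omega⟩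
  refine ⟨lam i₀, ?_, ?_⟩
  · obtain ⟨x, hx, hx0⟩ := (Submodule.ne_bot_iff _).1 (hne i₀)
    have h : 0 < B (Λ x) x := hΛpos x (hm𝔫 i₀ hx) hx0
    rw [hlam i₀ x hx, map_smul, LinearMap.smul_apply, smul_eq_mul] at h
    exact pos_of_mul_pos_left h (hB.nonneg x)
  · have hle : 𝔪 ≤ LinearMap.ker (Λ - lam i₀ • LinearMap.id) := by
      rw [← hmsum]
      refine iSup_le fun i x hx => ?_
      simp [hlam i x hx, hconst i i₀]
    intro x hx
    simpa [sub_eq_zero] using hle hx
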